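/- Let G be a simple graph on n vertices with n ≥ 2 whose maximum degree is at most Δ, where Δ ≥ 2, and let c ≥ 1 be a real number. Form a random vertex subset S by including each vertex of G independently with probability p, where p ≤ Δ^{-4}. For each vertex v, let R(v) denote the set of vertices of S reachable from v inside the induced subgraph G[S] (so R(v) is empty when v ∉ S). Then, with probability at least 1 − n^{−c}, every vertex v satisfies |R(v)| ≤ (c+1)·(log n)/(log Δ). -/

import Mathlib

open MeasureTheory ENNReal NNReal

/-- The subgraph of `G` induced by the vertex set `S` (vertices outside `S` are isolated):
adjacency requires both endpoints to lie in `S`. -/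
def inducedOn {V : Type*} (G : SimpleGraph V) (S : Set V) : SimpleGraph V :=
  SimpleGraph.fromRel (fun a b => G.Adj a b ∧ a ∈ S ∧ b ∈ S)

/-- `reachSet G S v` is the set of vertices of `S` reachable from `v` inside the induced
subgraph `G[S]`; it is empty when `v ∉ S`. -/
def reachSet {V : Type*} (G : SimpleGraph V) (S : Set V) (v : V) : Set V :=
  {u | u ∈ S ∧ v ∈ S ∧ (inducedOn G S).Reachable v u}

theorem card_walks_le {V : Type*} [Fintype V] [DecidableEq V] (G : SimpleGraph V)
    [DecidableRel G.Adj] (Δ : ℕ) (hdeg : ∀ v : V, G.degree v ≤ Δ) (m : ℕ) :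
    ∀ u : V, ∑ w : V, (G.finsetWalkLength m u w).card ≤ Δ ^ m := by
  induction m with
  | zero =>
    intro u
    rw [Finset.sum_eq_single u]
    · simp [SimpleGraph.finsetWalkLength]
    · intro b _ hb
      simp [SimpleGraph.finsetWalkLength, hb.symm]
    · simp
  | succ m ih =>
    intro u
    have h1 : ∀ w, (G.finsetWalkLength (m+1) u w).card ≤
        ∑ x : G.neighborSet u, (G.finsetWalkLength m x w).card := by
      intro w
      rw [SimpleGraph.finsetWalkLength]
      refine Finset.card_biUnion_le.trans ?_
      simp
    calc _ ≤ ∑ w : V, ∑ x : G.neighborSet u, (G.finsetWalkLength m x w).card :=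
          Finset.sum_le_sum fun w _ => h1 w
      _ = ∑ x : G.neighborSet u, ∑ w : V, (G.finsetWalkLength m x w).card := Finset.sum_comm
      _ ≤ ∑ x : G.neighborSet u, Δ ^ m := Finset.sum_le_sum fun x _ => ih x
      _ = G.degree u * Δ ^ m := by
        rw [Finset.sum_const, smul_eq_mul, Finset.card_univ, SimpleGraph.card_neighborSet_eq_degree]
      _ ≤ Δ * Δ ^ m := Nat.mul_le_mul_right _ (hdeg u)
      _ = Δ ^ (m+1) := by ring

theorem exists_cover_walk {V : Type*} [Fintype V] [DecidableEq V] (G : SimpleGraph V)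
    (S : Set V) (v : V) (j : ℕ) (hj : j + 1 ≤ (reachSet G S v).ncard) :
    ∃ w : G.Walk v v, w.length = 2 * j ∧ w.support.toFinset.card = j + 1 ∧
      ∀ x ∈ w.support, x ∈ S := by
  induction j with
  | zero =>
    have hne : (reachSet G S v).Nonempty := by
      rw [← Set.ncard_pos]; omega
    obtain ⟨u, hu⟩ := hne
    exact ⟨SimpleGraph.Walk.nil, by simp, by simp, by simpa using hu.2.1⟩
  | succ j ih =>
    obtain ⟨w, hl, hcard, hS⟩ := ih (by omega)
    obtain ⟨u, hu, huT⟩ : ∃ u ∈ reachSet G S v, u ∉ (w.support.toFinset : Set V) := by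
      refine Set.exists_mem_notMem_of_ncard_lt_ncard ?_ (Set.toFinite _)
      rw [Set.ncard_coe_finset]; omega
    obtain ⟨q⟩ := hu.2.2
    obtain ⟨d, -, ha, hb⟩ := q.exists_boundary_dart (w.support.toFinset : Set V) (by simp) huT
    have hadj := d.adj
    generalize d.fst = a at *
    generalize d.snd = b at *
    have hab : G.Adj a b ∧ b ∈ S := by
      rw [inducedOn, SimpleGraph.fromRel_adj] at hadj
      rcases hadj.2 with h | h
      · exact ⟨h.1, h.2.2⟩
      · exact ⟨h.1.symm, h.2.1⟩
    have ha' : a ∈ w.support := by simpa using ha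
    have hb' : b ∉ w.support := by simpa using hb
    let w' : G.Walk v v := (w.takeUntil a ha').append
      (SimpleGraph.Walk.cons hab.1 (SimpleGraph.Walk.cons hab.1.symm (w.dropUntil a ha')))
    have hmem : ∀ x, x ∈ w'.support ↔ x = b ∨ x ∈ w.support := by
      intro x
      have h3 : x ∈ w.support ↔ x ∈ (w.takeUntil a ha').support ∨
          x ∈ (w.dropUntil a ha').support := by
        conv_lhs => rw [← w.take_spec ha']
        rw [SimpleGraph.Walk.mem_support_append_iff]
      have h4 : a ∈ (w.takeUntil a ha').support := SimpleGraph.Walk.end_mem_support _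
      simp only [w', SimpleGraph.Walk.mem_support_append_iff, SimpleGraph.Walk.support_cons,
        List.mem_cons, h3]
      by_cases hx : x = a
      · subst hx; simp [h4]
      · tauto
    refine ⟨w', ?_, ?_, ?_⟩
    · have h5 := congrArg SimpleGraph.Walk.length (w.take_spec ha')
      rw [SimpleGraph.Walk.length_append] at h5
      simp only [w', SimpleGraph.Walk.length_append, SimpleGraph.Walk.length_cons]
      omega
    · have : w'.support.toFinset = insert b w.support.toFinset := by
        ext x; simp [hmem]
      rw [this, Finset.card_insert_of_notMem (by simpa using hb'), hcard]
    · intro x hx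
      rcases (hmem x).1 hx with rfl | h
      · exact hab.2
      · exact hS x h

theorem pi_all_true {V : Type*} [Fintype V] [DecidableEq V] (μ : Measure Bool)
    [IsProbabilityMeasure μ] (T : Finset V) :
    Measure.pi (fun _ : V => μ) {S : V → Bool | ∀ x ∈ T, S x = true} = μ {true} ^ T.card := by
  have : {S : V → Bool | ∀ x ∈ T, S x = true} =
      Set.univ.pi (fun x => if x ∈ T then {true} else Set.univ) := by
    ext S
    simp only [Set.mem_ofPred_eq, Set.mem_pi, Set.mem_univ, true_implies]
    refine forall_congr' fun x => ?_
    by_cases hx : x ∈ T <;> simp [hx]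
  rw [this, Measure.pi_pi]
  have : ∀ x : V, μ (if x ∈ T then {true} else Set.univ) = if x ∈ T then μ {true} else 1 := by
    intro x; split_ifs <;> simp only [measure_univ]
  simp only [this, Finset.prod_ite_mem, Finset.univ_inter, Finset.prod_const]

theorem stmt0 {V : Type*} [Fintype V] [DecidableEq V] (G : SimpleGraph V)
    [DecidableRel G.Adj]
    (n : ℕ) (hn : Fintype.card V = n) (hn2 : 2 ≤ n)
    (Δ : ℕ) (hΔ : 2 ≤ Δ) (hdeg : ∀ v : V, G.degree v ≤ Δ)
    (c : ℝ) (hc : 1 ≤ c)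
    (p : ℝ≥0∞) (hp1 : p ≤ 1) (hp : p ≤ ((Δ : ℝ≥0∞) ^ 4)⁻¹) :
    (1 : ℝ≥0∞) - (n : ℝ≥0∞) ^ (-c) ≤
      Measure.pi (fun _ : V => (PMF.ofFintype (fun b : Bool => cond b p (1 - p)) (by simp [hp1])).toMeasure)
        {S : V → Bool | ∀ v : V,
          ((reachSet G {x | S x = true} v).ncard : ℝ) ≤
            (c + 1) * Real.log n / Real.log Δ} := by
  have hpt : (PMF.ofFintype (fun b : Bool => cond b p (1 - p)) (by simp [hp1])).toMeasure {true}
      = p := by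
    rw [PMF.toMeasure_apply_singleton _ _ (MeasurableSet.singleton _)]
    simp
  generalize hμ : (PMF.ofFintype (fun b : Bool => cond b p (1 - p)) (by simp [hp1])).toMeasure = μ
    at hpt ⊢
  have : IsProbabilityMeasure μ := by rw [← hμ]; infer_instance
  set L : ℝ := (c + 1) * Real.log n / Real.log Δ with hL
  set A : Set (V → Bool) := {S : V → Bool | ∀ v : V,
          ((reachSet G {x | S x = true} v).ncard : ℝ) ≤ L} with hA
  have hlogΔ : 0 < Real.log Δ := Real.log_pos (by exact_mod_cast hΔ)
  have hlogn : 0 < Real.log n := Real.log_pos (by exact_mod_cast hn2)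
  have hL0 : 0 ≤ L := by positivity
  set j : ℕ := ⌊L⌋₊ with hj
  have hLj : L < (j : ℝ) + 1 := Nat.lt_floor_add_one L
  -- numeric bound
  have hpow : (n : ℝ≥0∞) ^ (c + 1) ≤ (Δ : ℝ≥0∞) ^ (j + 1) := by
    have h1 : (n : ℝ) ^ (c + 1) ≤ (Δ : ℝ) ^ (j + 1) := by
      have hn0 : (0 : ℝ) < n := by positivity
      have hΔ0 : (0 : ℝ) < Δ := by positivity
      rw [← Real.log_le_log_iff (by positivity) (by positivity), Real.log_rpow hn0, Real.log_pow]
      rw [hL, div_lt_iff₀ hlogΔ] at hLj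
      push_cast
      exact hLj.le
    have h2 := ENNReal.ofReal_le_ofReal h1
    rw [← ENNReal.ofReal_rpow_of_pos (by positivity), ENNReal.ofReal_pow (by positivity)] at h2
    simpa using h2
  have hcover : Aᶜ ⊆ ⋃ v : V, ⋃ w ∈ (G.finsetWalkLength (2 * j) v v).filter
      (fun w => w.support.toFinset.card = j + 1),
      {S : V → Bool | ∀ x ∈ w.support.toFinset, S x = true} := by
    intro S hS
    simp only [hA, Set.mem_compl_iff, Set.mem_ofPred_eq, not_forall, not_le] at hS
    obtain ⟨v, hv⟩ := hS
    obtain ⟨w, h1, h2, h3⟩ := exists_cover_walk G {x | S x = true} v j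
      ((Nat.floor_lt hL0).2 hv)
    simp only [Set.mem_iUnion]
    exact ⟨v, w, by simp [SimpleGraph.mem_finsetWalkLength_iff, h1, h2], by simpa using h3⟩
  have hbad : Measure.pi (fun _ : V => μ) Aᶜ ≤ (n : ℝ≥0∞) ^ (-c) := by
    have hΔ0 : (Δ : ℝ≥0∞) ≠ 0 := by simp; omega
    have hΔ1 : (1 : ℝ≥0∞) ≤ Δ := by exact_mod_cast (by omega : 1 ≤ Δ)
    have hn0 : (n : ℝ≥0∞) ≠ 0 := by simp; omega
    calc Measure.pi (fun _ : V => μ) Aᶜ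
        ≤ ∑ v : V, ∑ w ∈ (G.finsetWalkLength (2 * j) v v).filter
            (fun w => w.support.toFinset.card = j + 1),
            Measure.pi (fun _ : V => μ) {S : V → Bool | ∀ x ∈ w.support.toFinset, S x = true} := by
          refine (measure_mono hcover).trans ((measure_iUnion_fintype_le _ _).trans ?_)
          exact Finset.sum_le_sum fun v _ => measure_biUnion_finset_le _ _
      _ = ∑ v : V, ∑ w ∈ (G.finsetWalkLength (2 * j) v v).filter
            (fun w => w.support.toFinset.card = j + 1), p ^ (j + 1) := by
          refine Finset.sum_congr rfl fun v _ => Finset.sum_congr rfl fun w hw => ?_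
          rw [pi_all_true, hpt, (Finset.mem_filter.1 hw).2]
      _ ≤ ∑ v : V, (Δ : ℝ≥0∞) ^ (2 * j) * p ^ (j + 1) := by
          refine Finset.sum_le_sum fun v _ => ?_
          rw [Finset.sum_const, nsmul_eq_mul]
          gcongr
          have h1 := card_walks_le G Δ hdeg (2 * j) v
          have h2 := Finset.single_le_sum (f := fun w => (G.finsetWalkLength (2 * j) v w).card)
            (fun _ _ => Nat.zero_le _) (Finset.mem_univ v)
          exact_mod_cast (Finset.card_filter_le _ _).trans (h2.trans h1)
      _ = n * ((Δ : ℝ≥0∞) ^ (2 * j) * p ^ (j + 1)) := by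
          simp [hn]
      _ ≤ n * ((Δ : ℝ≥0∞) ^ (3 * (j + 1)) * (((Δ : ℝ≥0∞) ^ 4)⁻¹) ^ (j + 1)) := by
          exact mul_le_mul_right (mul_le_mul' (pow_le_pow_right₀ hΔ1 (by omega))
            (pow_le_pow_left' hp _)) _
      _ = n * ((Δ : ℝ≥0∞) ^ (j + 1))⁻¹ := by
          congr 1
          rw [← ENNReal.inv_pow, ← pow_mul,
            show 4 * (j + 1) = 3 * (j + 1) + (j + 1) by ring, pow_add,
            ENNReal.mul_inv (by simp) (by simp), ← mul_assoc,
            ENNReal.mul_inv_cancel (by positivity) (by finiteness), one_mul]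
      _ ≤ n * ((n : ℝ≥0∞) ^ (c + 1))⁻¹ := by
          gcongr
      _ = (n : ℝ≥0∞) ^ (-c) := by
          rw [← ENNReal.rpow_neg, show -c = 1 + -(c + 1) by ring,
            ENNReal.rpow_add _ _ hn0 (by simp), ENNReal.rpow_one]
  rw [tsub_le_iff_right]
  calc (1 : ℝ≥0∞) = Measure.pi (fun _ : V => μ) (A ∪ Aᶜ) := by simp
    _ ≤ _ := measure_union_le _ _
    _ ≤ _ := by gcongr
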